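/- Let A = [y₁,y₂] ⊆ [0,1], β ∈ ℝ, and let {q_n} be a sequence of positive reals with lim_{n→∞} n(1−q_n) = β. Then lim_{n→∞} max_{i∈{1,…,n}} | E_{μ_{n,q_n}}[ 1_A(π(i)/n) ] − ∫_{y₁}^{y₂} u(i/n, y, β) dy | = 0; that is, the probability that π(i)/n lies in A converges to ∫_{y₁}^{y₂} u(i/n, y, β) dy uniformly over i ∈ {1,…,n}. -/

import Mathlib

open Filter Finset MeasureTheory

/-- Number of inversions of a permutation of `Fin n`. -/
def inversions (n : ℕ) (π : Equiv.Perm (Fin n)) : ℕ :=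
  (Finset.univ.filter (fun p : Fin n × Fin n => p.1 < p.2 ∧ π p.2 < π p.1)).card

/-- The `(n,q)`-Mallows probability mass function on `S_n`. -/
noncomputable def mallowsPMF (n : ℕ) (q : ℝ) (π : Equiv.Perm (Fin n)) : ℝ :=
  q ^ inversions n π / ∑ σ : Equiv.Perm (Fin n), q ^ inversions n σ

open Classical in
/-- The `(n,q)`-Mallows probability of an event `P` of permutations. -/
noncomputable def mallowsProb (n : ℕ) (q : ℝ) (P : Equiv.Perm (Fin n) → Prop) : ℝ :=
  ∑ π : Equiv.Perm (Fin n), if P π then mallowsPMF n q π else 0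

/-- Expectation with respect to the `(n,q)`-Mallows measure. -/
noncomputable def mallowsExp (n : ℕ) (q : ℝ) (f : Equiv.Perm (Fin n) → ℝ) : ℝ :=
  ∑ π : Equiv.Perm (Fin n), mallowsPMF n q π * f π

/-- Action of a permutation of `Fin n` on one-based indices `{1,…,n}`. -/
def permAct (n : ℕ) (π : Equiv.Perm (Fin n)) (i : ℕ) : ℕ :=
  if h : 1 ≤ i ∧ i ≤ n then ((π ⟨i - 1, by omega⟩ : Fin n) : ℕ) + 1 else i

/-- The limiting density `u(x,y,β)` from Starr's theorem. -/
noncomputable def mallowsU (x y β : ℝ) : ℝ :=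
  if β = 0 then 1
  else (β / 2) * Real.sinh (β / 2) /
    (Real.exp (β / 4) * Real.cosh (β * (x - y) / 2)
      - Real.exp (-β / 4) * Real.cosh (β * (x + y - 1) / 2)) ^ 2

/-- The `q`-analogue `1 + q + ⋯ + q ^ (m - 1)` of `m`. -/
noncomputable def qNumber (q : ℝ) (m : ℕ) : ℝ := ∑ b ∈ Finset.range m, q ^ b

/-- The number of positions below `k` that `π` maps to a value below `j`. -/
def cornerCount (n j k : ℕ) (π : Equiv.Perm (Fin n)) : ℕ :=
  (Finset.univ.filter (fun p : Fin n => (p : ℕ) < k ∧ (π p : ℕ) < j)).card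

section QNumber

variable {q : ℝ}

@[simp] lemma qNumber_zero : qNumber q 0 = 0 := by simp [qNumber]

lemma qNumber_succ (m : ℕ) : qNumber q (m + 1) = qNumber q m + q ^ m := by
  simp [qNumber, Finset.sum_range_succ]

lemma qNumber_mul_one_sub (m : ℕ) : (1 - q) * qNumber q m = 1 - q ^ m := by
  unfold qNumber
  linarith [mul_neg_geom_sum q m]

lemma qNumber_nonneg (hq : 0 < q) (m : ℕ) : 0 ≤ qNumber q m :=
  Finset.sum_nonneg fun _ _ => by positivity

lemma qNumber_pos (hq : 0 < q) {m : ℕ} (hm : 0 < m) : 0 < qNumber q m :=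
  Finset.sum_pos (fun _ _ => by positivity) (by simpa using hm.ne')

end QNumber

section Expectation

variable {n : ℕ} {q : ℝ}

lemma mallows_partition_pos (hq : 0 < q) :
    0 < ∑ σ : Equiv.Perm (Fin n), q ^ inversions n σ :=
  Finset.sum_pos (fun _ _ => by positivity) Finset.univ_nonempty

lemma mallowsPMF_nonneg (hq : 0 < q) (π : Equiv.Perm (Fin n)) : 0 ≤ mallowsPMF n q π :=
  div_nonneg (by positivity) (mallows_partition_pos hq).le

lemma mallowsExp_const (hq : 0 < q) (c : ℝ) : mallowsExp n q (fun _ => c) = c := by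
  unfold mallowsExp mallowsPMF
  rw [← Finset.sum_mul, ← Finset.sum_div, div_self (mallows_partition_pos hq).ne', one_mul]

lemma mallowsExp_add (f g : Equiv.Perm (Fin n) → ℝ) :
    mallowsExp n q (fun π => f π + g π) = mallowsExp n q f + mallowsExp n q g := by
  simp [mallowsExp, mul_add, Finset.sum_add_distrib]

lemma mallowsExp_sub (f g : Equiv.Perm (Fin n) → ℝ) :
    mallowsExp n q (fun π => f π - g π) = mallowsExp n q f - mallowsExp n q g := by
  simp [mallowsExp, mul_sub, Finset.sum_sub_distrib]

lemma mallowsExp_const_mul (c : ℝ) (f : Equiv.Perm (Fin n) → ℝ) :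
    mallowsExp n q (fun π => c * f π) = c * mallowsExp n q f := by
  simp only [mallowsExp, Finset.mul_sum]
  exact Finset.sum_congr rfl fun _ _ => by ring

lemma mallowsExp_mono (hq : 0 < q) {f g : Equiv.Perm (Fin n) → ℝ} (h : ∀ π, f π ≤ g π) :
    mallowsExp n q f ≤ mallowsExp n q g :=
  Finset.sum_le_sum fun π _ => mul_le_mul_of_nonneg_left (h π) (mallowsPMF_nonneg hq π)

lemma sq_mallowsExp_le (hq : 0 < q) (f : Equiv.Perm (Fin n) → ℝ) :
    mallowsExp n q f ^ 2 ≤ mallowsExp n q (fun π => f π ^ 2) := by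
  have h := mallowsExp_mono (n := n) hq (f := fun _ => 0)
    (g := fun π => (f π ^ 2 - (2 * mallowsExp n q f) * f π) + mallowsExp n q f ^ 2)
    (fun π => by nlinarith [sq_nonneg (f π - mallowsExp n q f)])
  rw [mallowsExp_add, mallowsExp_sub, mallowsExp_const_mul, mallowsExp_const hq,
    mallowsExp_const hq] at h
  nlinarith

lemma mallowsProb_eq_mallowsExp (P : Equiv.Perm (Fin n) → Prop) [DecidablePred P] :
    mallowsProb n q P = mallowsExp n q (fun π => if P π then 1 else 0) := by
  unfold mallowsProb mallowsExp
  refine Finset.sum_congr rfl fun π _ => ?_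
  by_cases h : P π <;> simp [h]

end Expectation

section CornerCount

variable {n : ℕ}

lemma inversions_mul_swap (π : Equiv.Perm (Fin n)) {l : ℕ} (hl : l + 1 < n)
    (h : π ⟨l, by omega⟩ < π ⟨l + 1, hl⟩) :
    inversions n (π * Equiv.swap ⟨l, by omega⟩ ⟨l + 1, hl⟩) = inversions n π + 1 := by
  set a : Fin n := ⟨l, by omega⟩ with ha
  set b : Fin n := ⟨l + 1, hl⟩ with hb
  set s := Equiv.swap a b with hs
  have hab : a < b := by simp [ha, hb, Fin.lt_def]
  have hmono : ∀ x y : Fin n, x < y → (x, y) ≠ (a, b) → s x < s y := by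
    intro x y hxy hne
    simp only [ne_eq, Prod.mk.injEq, not_and] at hne
    simp only [hs, Equiv.swap_apply_def, ha, hb, Fin.ext_iff, Fin.lt_def] at hxy hne ⊢
    split_ifs <;> simp_all <;> omega
  have hss : ∀ x, s (s x) = x := fun x => Equiv.swap_apply_self a b x
  have hset : (Finset.univ.filter (fun p : Fin n × Fin n =>
        p.1 < p.2 ∧ (π * s) p.2 < (π * s) p.1)) =
      insert (a, b) ((Finset.univ.filter (fun p : Fin n × Fin n =>
        p.1 < p.2 ∧ π p.2 < π p.1)).map (s.prodCongr s).toEmbedding) := by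
    ext ⟨x, y⟩
    simp only [Finset.mem_filter]
    simp only [Finset.mem_univ, true_and, Equiv.Perm.mul_apply, Finset.mem_filter,
      Finset.mem_insert, Finset.mem_map, Equiv.toEmbedding_apply, Equiv.prodCongr_apply,
      Prod.exists, Prod.map_apply, Prod.mk.injEq]
    constructor
    · rintro ⟨hxy, hinv⟩
      by_cases hne : x = a ∧ y = b
      · exact Or.inl hne
      · refine Or.inr ⟨s x, s y, ⟨hmono x y hxy (by simpa using hne), hinv⟩, hss x, hss y⟩
    · rintro (⟨rfl, rfl⟩ | ⟨x', y', ⟨hxy, hinv⟩, rfl, rfl⟩)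
      · refine ⟨hab, ?_⟩
        simpa [hs] using h
      · rw [hss, hss]
        refine ⟨hmono x' y' hxy ?_, hinv⟩
        rintro heq
        simp only [Prod.mk.injEq] at heq
        rw [heq.1, heq.2] at hinv
        exact absurd hinv h.not_gt
  unfold inversions
  rw [hset, Finset.card_insert_of_notMem, Finset.card_map]
  simp only [Finset.mem_map, Finset.mem_filter, Finset.mem_univ, true_and,
    Equiv.toEmbedding_apply, Equiv.prodCongr_apply, Prod.exists, Prod.map_apply, Prod.mk.injEq,
    not_exists, not_and]
  rintro x y hxy hx hy
  have hx' : x = b := by rw [← hss x, hx]; simp [hs]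
  have hy' : y = a := by rw [← hss y, hy]; simp [hs]
  rw [hx', hy'] at hxy
  exact absurd hxy.1 hab.not_gt

lemma cornerCount_zero (j : ℕ) (π : Equiv.Perm (Fin n)) : cornerCount n j 0 π = 0 := by
  simp [cornerCount]

lemma cornerCount_succ (j : ℕ) (π : Equiv.Perm (Fin n)) {k : ℕ} (hk : k < n) :
    cornerCount n j (k + 1) π =
      cornerCount n j k π + if (π ⟨k, hk⟩ : ℕ) < j then 1 else 0 := by
  unfold cornerCount
  have hp : ∀ p : Fin n, ((p : ℕ) < k + 1 ∧ (π p : ℕ) < j) ↔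
      (((p : ℕ) < k ∧ (π p : ℕ) < j) ∨ (p = ⟨k, hk⟩ ∧ (π ⟨k, hk⟩ : ℕ) < j)) := by
    intro p
    constructor
    · rintro ⟨h1, h2⟩
      rcases Nat.lt_succ_iff_lt_or_eq.mp h1 with h | h
      · exact Or.inl ⟨h, h2⟩
      · obtain rfl : p = ⟨k, hk⟩ := Fin.ext h
        exact Or.inr ⟨rfl, h2⟩
    · rintro (⟨h1, h2⟩ | ⟨rfl, h2⟩)
      · exact ⟨by omega, h2⟩
      · exact ⟨by simp, h2⟩
  simp_rw [hp]
  rw [Finset.filter_or, Finset.card_union_of_disjoint]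
  · congr 1
    split_ifs with h
    · simp [h, Finset.filter_eq']
    · simp [h]
  · rw [Finset.disjoint_filter]
    rintro p - h1 ⟨rfl, -⟩
    exact absurd h1.1 (lt_irrefl k)

lemma cornerCount_self {j : ℕ} (hj : j ≤ n) (π : Equiv.Perm (Fin n)) :
    cornerCount n j n π = j := by
  unfold cornerCount
  have h : (Finset.univ.filter (fun p : Fin n => (p : ℕ) < n ∧ (π p : ℕ) < j)) =
      (Finset.univ.filter (fun p : Fin n => (p : ℕ) < j)).map π.symm.toEmbedding := by
    ext p
    simp only [Fin.is_lt, true_and, Finset.mem_filter, Finset.mem_univ, Finset.mem_map_equiv,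
      Equiv.symm_symm]
  rw [h, Finset.card_map, Fin.card_filter_val_lt, min_eq_right hj]

lemma cornerCount_le (j : ℕ) (π : Equiv.Perm (Fin n)) (k : ℕ) : cornerCount n j k π ≤ n :=
  (Finset.card_le_univ _).trans_eq (Fintype.card_fin n)

lemma cornerCount_mul_swap (j : ℕ) (π : Equiv.Perm (Fin n)) {k l : ℕ} (hkl : k ≤ l)
    (hl : l + 1 < n) :
    cornerCount n j k (π * Equiv.swap ⟨l, by omega⟩ ⟨l + 1, hl⟩) = cornerCount n j k π := by
  unfold cornerCount
  congr 1
  refine Finset.filter_congr fun p _ => and_congr_right fun hp => ?_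
  rw [Equiv.Perm.mul_apply, Equiv.swap_apply_of_ne_of_ne] <;>
    exact fun h => by simp [Fin.ext_iff] at h; omega

variable {q : ℝ}

lemma qNumber_cornerCount_succ_sub (j : ℕ) (π : Equiv.Perm (Fin n)) {k : ℕ} (hk : k < n) :
    qNumber q (cornerCount n j (k + 1) π) - qNumber q (cornerCount n j k π) =
      q ^ cornerCount n j k π * if (π ⟨k, hk⟩ : ℕ) < j then 1 else 0 := by
  rw [cornerCount_succ j π hk]
  split_ifs <;> simp [qNumber_succ]

lemma mallowsPMF_mul_swap (π : Equiv.Perm (Fin n)) {l : ℕ} (hl : l + 1 < n)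
    (h : π ⟨l, by omega⟩ < π ⟨l + 1, hl⟩) :
    mallowsPMF n q (π * Equiv.swap ⟨l, by omega⟩ ⟨l + 1, hl⟩) = q * mallowsPMF n q π := by
  unfold mallowsPMF
  rw [inversions_mul_swap π hl h]
  ring

/-- `q`-exchangeability: transposing adjacent positions multiplies the expected increment
by `q`. -/
lemma mallowsExp_increment_succ (j : ℕ) {l : ℕ} (hl : l + 1 < n)
    (φ : Equiv.Perm (Fin n) → ℝ)
    (hφ : ∀ π, φ (π * Equiv.swap ⟨l, by omega⟩ ⟨l + 1, hl⟩) = φ π) :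
    mallowsExp n q (fun π => φ π * (qNumber q (cornerCount n j (l + 1 + 1) π) -
        qNumber q (cornerCount n j (l + 1) π))) =
      q * mallowsExp n q (fun π => φ π * (qNumber q (cornerCount n j (l + 1) π) -
        qNumber q (cornerCount n j l π))) := by
  have hl' : l < n := by omega
  set a : Fin n := ⟨l, hl'⟩ with ha
  set b : Fin n := ⟨l + 1, hl⟩ with hb
  set s := Equiv.swap a b with hs
  rw [← sub_eq_zero, ← mallowsExp_const_mul, ← mallowsExp_sub]
  unfold mallowsExp
  set G : Equiv.Perm (Fin n) → ℝ := fun π => mallowsPMF n q π *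
    (φ π * (qNumber q (cornerCount n j (l + 1 + 1) π) -
        qNumber q (cornerCount n j (l + 1) π)) -
      q * (φ π * (qNumber q (cornerCount n j (l + 1) π) -
        qNumber q (cornerCount n j l π)))) with hG
  have hss : ∀ π : Equiv.Perm (Fin n), π * s * s = π := by
    intro π
    rw [mul_assoc, Equiv.swap_mul_self, mul_one]
  have hcount : ∀ σ : Equiv.Perm (Fin n), cornerCount n j (l + 1) σ =
      cornerCount n j l σ + if (σ a : ℕ) < j then 1 else 0 := fun σ => cornerCount_succ j σ hl'
  have hinc₀ : ∀ σ : Equiv.Perm (Fin n),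
      qNumber q (cornerCount n j (l + 1) σ) - qNumber q (cornerCount n j l σ) =
        q ^ cornerCount n j l σ * if (σ a : ℕ) < j then 1 else 0 :=
    fun σ => qNumber_cornerCount_succ_sub j σ hl'
  have hinc₁ : ∀ σ : Equiv.Perm (Fin n),
      qNumber q (cornerCount n j (l + 1 + 1) σ) - qNumber q (cornerCount n j (l + 1) σ) =
        q ^ cornerCount n j (l + 1) σ * if (σ b : ℕ) < j then 1 else 0 :=
    fun σ => qNumber_cornerCount_succ_sub j σ hl
  have key : ∀ π : Equiv.Perm (Fin n), (π a : ℕ) < j → ¬ (π b : ℕ) < j →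
      G π + G (π * s) = 0 := by
    intro π h1 h2
    have hlt : π a < π b := by rw [Fin.lt_def]; omega
    have h1' : ((π * s) b : ℕ) < j := by simpa [hs] using h1
    have h2' : ¬ ((π * s) a : ℕ) < j := by simpa [hs] using h2
    simp only [hG, hinc₀, hinc₁]
    rw [mallowsPMF_mul_swap π hl hlt, hφ, hcount (π * s),
      cornerCount_mul_swap j π le_rfl hl]
    simp only [if_pos h1, if_neg h2, if_pos h1', if_neg h2']
    ring
  have hpair : ∀ π, G π + G (π * s) = 0 := by
    intro π
    by_cases h1 : (π a : ℕ) < j <;> by_cases h2 : (π b : ℕ) < j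
    · have hz : ∀ σ : Equiv.Perm (Fin n), (σ a : ℕ) < j → (σ b : ℕ) < j → G σ = 0 := by
        intro σ h1 h2
        simp only [hG, hinc₀, hinc₁]
        simp only [hcount σ, if_pos h1, if_pos h2]
        ring
      rw [hz π h1 h2, hz (π * s) (by simpa [hs] using h2) (by simpa [hs] using h1), add_zero]
    · exact key π h1 h2
    · have := key (π * s) (by simpa [hs] using h2) (by simpa [hs] using h1)
      rw [hss] at this
      rw [add_comm]
      exact this
    · have hz : ∀ σ : Equiv.Perm (Fin n), ¬ (σ a : ℕ) < j → ¬ (σ b : ℕ) < j → G σ = 0 := by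
        intro σ h1 h2
        simp only [hG, hinc₀, hinc₁]
        rw [if_neg h1, if_neg h2]
        ring
      rw [hz π h1 h2, hz (π * s) (by simpa [hs] using h2) (by simpa [hs] using h1), add_zero]
  have hcomp : ∑ π, G (π * s) = ∑ π, G π := Equiv.sum_comp (Equiv.mulRight s) G
  have hsum : ∑ π, G π + ∑ π, G (π * s) = 0 := by
    rw [← Finset.sum_add_distrib]
    exact Finset.sum_eq_zero fun π _ => hpair π
  rw [hcomp] at hsum
  change ∑ π, G π = 0
  linarith

/-- Against a weight that is invariant under transposing adjacent positions from `k` on, the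
expected increments from `k` on form a geometric progression. -/
lemma mallowsExp_increment_add (j k m : ℕ) (hkm : k + m < n) (φ : Equiv.Perm (Fin n) → ℝ)
    (hφ : ∀ (l : ℕ) (hl : l + 1 < n), k ≤ l → ∀ π,
      φ (π * Equiv.swap ⟨l, by omega⟩ ⟨l + 1, hl⟩) = φ π) :
    mallowsExp n q (fun π => φ π * (qNumber q (cornerCount n j (k + m + 1) π) -
        qNumber q (cornerCount n j (k + m) π))) =
      q ^ m * mallowsExp n q (fun π => φ π * (qNumber q (cornerCount n j (k + 1) π) -
        qNumber q (cornerCount n j k π))) := by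
  induction m with
  | zero => simp
  | succ m ih =>
    rw [pow_succ', mul_assoc, ← ih (by omega) hφ]
    exact mallowsExp_increment_succ j hkm φ (hφ (k + m) hkm (by omega))

/-- Summed form of `mallowsExp_increment_add`. -/
lemma mallowsExp_sub_eq_qNumber_mul (j k m : ℕ) (hkm : k + m ≤ n)
    (φ : Equiv.Perm (Fin n) → ℝ)
    (hφ : ∀ (l : ℕ) (hl : l + 1 < n), k ≤ l → ∀ π,
      φ (π * Equiv.swap ⟨l, by omega⟩ ⟨l + 1, hl⟩) = φ π) :
    mallowsExp n q (fun π => φ π * (qNumber q (cornerCount n j (k + m) π) -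
        qNumber q (cornerCount n j k π))) =
      qNumber q m * mallowsExp n q (fun π => φ π * (qNumber q (cornerCount n j (k + 1) π) -
        qNumber q (cornerCount n j k π))) := by
  induction m with
  | zero => simp [mallowsExp]
  | succ m ih =>
    rw [qNumber_succ, add_mul, ← ih (by omega) hφ,
      ← mallowsExp_increment_add j k m (by omega) φ hφ, ← mallowsExp_add]
    congr 1
    ext π
    rw [← add_assoc k m 1]
    ring

lemma mallowsExp_qNumber_cornerCount (hq : 0 < q) {j k : ℕ} (hj : j ≤ n) (hk : k ≤ n)
    (hn : 0 < n) :
    mallowsExp n q (fun π => qNumber q (cornerCount n j k π)) =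
      qNumber q k * qNumber q j / qNumber q n := by
  have h : ∀ m ≤ n, mallowsExp n q (fun π => qNumber q (cornerCount n j m π)) =
      qNumber q m * mallowsExp n q (fun π => qNumber q (cornerCount n j 1 π)) := by
    intro m hm
    have := mallowsExp_sub_eq_qNumber_mul (n := n) (q := q) j 0 m (by omega) (fun _ => 1)
      (fun _ _ _ _ => rfl)
    simpa [cornerCount_zero] using this
  have hn' := h n le_rfl
  simp only [cornerCount_self hj, mallowsExp_const hq] at hn'
  rw [h k hk, hn']
  field_simp [(qNumber_pos hq hn).ne']

lemma variance_qNumber_cornerCount_le (hq : 0 < q) {j k : ℕ} (hj : j ≤ n) (hk : k ≤ n)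
    (hn : 0 < n) {C : ℝ} (hC : ∀ b ≤ n, q ^ b ≤ C) :
    mallowsExp n q (fun π => (qNumber q (cornerCount n j k π) -
      qNumber q k * qNumber q j / qNumber q n) ^ 2) ≤ k * C ^ 2 := by
  have hC0 : 0 ≤ C := by have := hC 0 (by omega); simp at this; linarith
  induction k with
  | zero => simp [cornerCount_zero, mallowsExp]
  | succ k ih =>
    have hk' : k < n := hk
    specialize ih hk'.le
    set m : ℕ → ℝ := fun k => qNumber q k * qNumber q j / qNumber q n with hm
    set X : ℕ → Equiv.Perm (Fin n) → ℝ := fun k π => qNumber q (cornerCount n j k π) with hX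
    have hEX : ∀ k ≤ n, mallowsExp n q (X k) = m k := fun k hk =>
      mallowsExp_qNumber_cornerCount hq hj hk hn
    have hEY : mallowsExp n q (fun π => X k π - m k) = 0 := by
      rw [mallowsExp_sub, hEX k hk'.le, mallowsExp_const hq, sub_self]
    have hcross : qNumber q (n - k) *
        mallowsExp n q (fun π => (X k π - m k) * (X (k + 1) π - X k π)) =
        - mallowsExp n q (fun π => (X k π - m k) ^ 2) := by
      rw [← mallowsExp_sub_eq_qNumber_mul (n := n) (q := q) j k (n - k) (by omega)
        (fun π => X k π - m k) (fun l hl hkl π => by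
          simp only [hX]; rw [cornerCount_mul_swap j π hkl hl])]
      rw [show k + (n - k) = n by omega]
      simp only [cornerCount_self hj]
      have : ∀ π, (X k π - m k) * (qNumber q j - X k π) =
          (qNumber q j - m k) * (X k π - m k) - (X k π - m k) ^ 2 := fun π => by ring
      simp only [hX] at this
      simp only [hX, this]
      rw [mallowsExp_sub, mallowsExp_const_mul, hEY]
      simp
    have hV : 0 ≤ mallowsExp n q (fun π => (X k π - m k) ^ 2) := by
      have := mallowsExp_mono (n := n) hq (f := fun _ => 0)
        (g := fun π => (X k π - m k) ^ 2) (fun π => sq_nonneg _)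
      rwa [mallowsExp_const hq] at this
    have hcross' : mallowsExp n q (fun π => (X k π - m k) * (X (k + 1) π - X k π)) ≤ 0 := by
      have hp := qNumber_pos hq (m := n - k) (by omega)
      by_contra! hcon
      have := mul_pos hp hcon
      linarith
    have hsq : mallowsExp n q (fun π => (X (k + 1) π - X k π) ^ 2) ≤ C ^ 2 := by
      rw [← mallowsExp_const (n := n) hq (C ^ 2)]
      refine mallowsExp_mono hq fun π => ?_
      simp only [hX]
      rw [qNumber_cornerCount_succ_sub j π hk']
      have h1 := hC _ (cornerCount_le j π k)
      have h2 : 0 < q ^ cornerCount n j k π := by positivity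
      split_ifs
      · rw [mul_one]; gcongr
      · simp; positivity
    have hEd : mallowsExp n q (fun π => X (k + 1) π - X k π) = m (k + 1) - m k := by
      rw [mallowsExp_sub, hEX _ hk, hEX _ hk'.le]
    have hexp : ∀ π, (X (k + 1) π - m (k + 1)) ^ 2 =
        ((((X k π - m k) ^ 2 + 2 * ((X k π - m k) * (X (k + 1) π - X k π))) +
          (X (k + 1) π - X k π) ^ 2) -
          (2 * (m (k + 1) - m k)) * (X k π - m k)) -
          (2 * (m (k + 1) - m k)) * (X (k + 1) π - X k π) + (m (k + 1) - m k) ^ 2 :=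
      fun π => by ring
    change mallowsExp n q (fun π => (X (k + 1) π - m (k + 1)) ^ 2) ≤ _
    simp only [hexp]
    rw [mallowsExp_add, mallowsExp_sub, mallowsExp_sub, mallowsExp_add, mallowsExp_add,
      mallowsExp_const_mul, mallowsExp_const_mul, mallowsExp_const_mul, hEY, hEd,
      mallowsExp_const hq]
    change mallowsExp n q (fun π => (X k π - m k) ^ 2) ≤ _ at ih
    push_cast
    nlinarith [sq_nonneg (m (k + 1) - m k)]

/-- Quantitative form of the marginal law: up to the fluctuations of the corner count, the
distribution function of `π k` solves a linear equation. -/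
lemma mallows_marginal_bound (hq : 0 < q) {j k : ℕ} (hj : j ≤ n) (hk : k < n)
    {C : ℝ} (hC : ∀ b ≤ n, q ^ b ≤ C) :
    (mallowsExp n q (fun π => if (π ⟨k, hk⟩ : ℕ) < j then 1 else 0) *
        (qNumber q n - (1 - q ^ k) * qNumber q j) - qNumber q j * q ^ k) ^ 2 ≤
      ((1 - q) * qNumber q n) ^ 2 * (n * C ^ 2) := by
  have hn : 0 < n := by omega
  have hGn := qNumber_pos hq hn
  set P := mallowsExp n q (fun π => if (π ⟨k, hk⟩ : ℕ) < j then 1 else 0) with hP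
  set μ := qNumber q k * qNumber q j / qNumber q n with hμ
  set Y : Equiv.Perm (Fin n) → ℝ := fun π => qNumber q (cornerCount n j k π) - μ with hY
  set D : Equiv.Perm (Fin n) → ℝ := fun π => if (π ⟨k, hk⟩ : ℕ) < j then 1 else 0 with hD
  have h1 : mallowsExp n q (fun π => q ^ cornerCount n j k π * D π) =
      q ^ k * qNumber q j / qNumber q n := by
    simp only [hD, ← qNumber_cornerCount_succ_sub j _ hk]
    rw [mallowsExp_sub, mallowsExp_qNumber_cornerCount hq hj hk hn,
      mallowsExp_qNumber_cornerCount hq hj hk.le hn, qNumber_succ]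
    ring
  have h2 : ∀ π, q ^ cornerCount n j k π * D π =
      (1 - (1 - q) * μ) * D π - (1 - q) * (Y π * D π) := by
    intro π
    have := qNumber_mul_one_sub (q := q) (cornerCount n j k π)
    simp only [hY]
    linear_combination D π * this
  simp only [h2] at h1
  rw [mallowsExp_sub, mallowsExp_const_mul, mallowsExp_const_mul] at h1
  have h3 : P * (qNumber q n - (1 - q ^ k) * qNumber q j) - qNumber q j * q ^ k =
      (1 - q) * qNumber q n * mallowsExp n q (fun π => Y π * D π) := by
    have hk1 := qNumber_mul_one_sub (q := q) k
    have hμ' : μ * qNumber q n = qNumber q k * qNumber q j := by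
      rw [hμ]; field_simp
    have h1' : ((1 - (1 - q) * μ) * P -
        (1 - q) * mallowsExp n q (fun π => Y π * D π)) * qNumber q n = q ^ k * qNumber q j := by
      rw [h1]; field_simp
    linear_combination h1' + P * (1 - q) * hμ' + P * qNumber q j * hk1
  rw [h3, mul_pow]
  refine mul_le_mul_of_nonneg_left ?_ (sq_nonneg _)
  calc _ ≤ mallowsExp n q (fun π => (Y π * D π) ^ 2) := sq_mallowsExp_le hq _
    _ ≤ mallowsExp n q (fun π => Y π ^ 2) := by
        refine mallowsExp_mono hq fun π => ?_
        simp only [hD]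
        split_ifs
        · simp
        · simpa using sq_nonneg (Y π)
    _ ≤ k * C ^ 2 := variance_qNumber_cornerCount_le hq hj hk.le hn hC
    _ ≤ n * C ^ 2 := by gcongr

end CornerCount

section Limit

open Real

/-- The limit of `[j]_q / n` when `j / n → y` and `n (1 - q) → β`. -/
noncomputable def qNumberLimit (β y : ℝ) : ℝ :=
  if β = 0 then y else (1 - exp (-β * y)) / β

/-- The denominator of the limiting conditional distribution function. -/
noncomputable def limitDenom (β x y : ℝ) : ℝ :=
  qNumberLimit β 1 - (1 - exp (-β * x)) * qNumberLimit β y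

/-- The limiting distribution function of `π(i)/n` given `i/n = x`. -/
noncomputable def limitCDF (β x y : ℝ) : ℝ :=
  qNumberLimit β y * exp (-β * x) / limitDenom β x y

lemma hasDerivAt_qNumberLimit (β y : ℝ) :
    HasDerivAt (qNumberLimit β) (exp (-β * y)) y := by
  by_cases hβ : β = 0
  · have h : qNumberLimit β = id := by ext; simp [qNumberLimit, hβ]
    rw [h]
    simpa [hβ] using hasDerivAt_id y
  · have h : qNumberLimit β = fun y => (1 - exp (-β * y)) / β := by
      ext; simp [qNumberLimit, hβ]
    rw [h]
    have h1 : HasDerivAt (fun y : ℝ => -β * y) (-β) y := by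
      simpa using (hasDerivAt_id y).const_mul (-β)
    refine ((h1.exp.const_sub 1).div_const β).congr_deriv ?_
    rw [div_eq_iff hβ]
    ring

lemma mul_qNumberLimit (β y : ℝ) : β * qNumberLimit β y = 1 - exp (-β * y) := by
  by_cases hβ : β = 0
  · simp [hβ]
  · rw [qNumberLimit, if_neg hβ, mul_div_cancel₀ _ hβ]

lemma qNumberLimit_zero_right (β : ℝ) : qNumberLimit β 0 = 0 := by
  simp [qNumberLimit]

lemma strictMono_qNumberLimit (β : ℝ) : StrictMono (qNumberLimit β) :=
  strictMono_of_hasDerivAt_pos (hasDerivAt_qNumberLimit β) fun _ => exp_pos _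

lemma qNumberLimit_one_pos (β : ℝ) : 0 < qNumberLimit β 1 := by
  rw [← qNumberLimit_zero_right β]
  exact strictMono_qNumberLimit β one_pos

lemma exp_neg_abs_le (β : ℝ) {x : ℝ} (hx0 : 0 ≤ x) (hx1 : x ≤ 1) :
    exp (-|β|) ≤ exp (-β * x) := by
  rw [exp_le_exp]
  nlinarith [abs_nonneg β, le_abs_self β, mul_le_mul_of_nonneg_right (le_abs_self β) hx0]

lemma exp_le_exp_abs (β : ℝ) {x : ℝ} (hx0 : 0 ≤ x) (hx1 : x ≤ 1) :
    exp (β * x) ≤ exp |β| := by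
  rw [exp_le_exp]
  nlinarith [abs_nonneg β, le_abs_self β, mul_le_mul_of_nonneg_right (le_abs_self β) hx0]

lemma le_limitDenom (β : ℝ) {x y : ℝ} (hx0 : 0 ≤ x) (hx1 : x ≤ 1) (hy0 : 0 ≤ y) (hy1 : y ≤ 1) :
    exp (-|β|) * qNumberLimit β 1 ≤ limitDenom β x y := by
  have h1 := exp_neg_abs_le β hx0 hx1
  have h2 : exp (-|β|) ≤ 1 := by simp
  have h3 : 0 ≤ qNumberLimit β y := by
    rw [← qNumberLimit_zero_right β]
    exact (strictMono_qNumberLimit β).monotone hy0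
  have h4 : qNumberLimit β y ≤ qNumberLimit β 1 := (strictMono_qNumberLimit β).monotone hy1
  unfold limitDenom
  nlinarith [mul_nonneg (sub_nonneg.2 h1) h3, mul_nonneg (sub_nonneg.2 h2) (sub_nonneg.2 h4)]

lemma limitDenom_pos (β : ℝ) {x y : ℝ} (hx0 : 0 ≤ x) (hx1 : x ≤ 1) (hy0 : 0 ≤ y) (hy1 : y ≤ 1) :
    0 < limitDenom β x y :=
  (mul_pos (exp_pos _) (qNumberLimit_one_pos β)).trans_le (le_limitDenom β hx0 hx1 hy0 hy1)

lemma mallowsU_eq {β x y : ℝ} (h : limitDenom β x y ≠ 0) :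
    mallowsU x y β =
      exp (-β * y) * exp (-β * x) * qNumberLimit β 1 / limitDenom β x y ^ 2 := by
  by_cases hβ : β = 0
  · simp [hβ, mallowsU, qNumberLimit, limitDenom]
  rw [mallowsU, if_neg hβ]
  set D := exp (β / 4) * cosh (β * (x - y) / 2) -
    exp (-β / 4) * cosh (β * (x + y - 1) / 2) with hD
  have hmul : β * limitDenom β x y = 2 * exp (-β / 4 - β * (x + y) / 2) * D := by
    have e1 : exp (-β / 4 - β * (x + y) / 2) * exp (β / 4) * exp (β * (x - y) / 2) =
        exp (-β * y) := by rw [← exp_add, ← exp_add]; congr 1; ring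
    have e2 : exp (-β / 4 - β * (x + y) / 2) * exp (β / 4) * exp (-(β * (x - y) / 2)) =
        exp (-β * x) := by rw [← exp_add, ← exp_add]; congr 1; ring
    have e3 : exp (-β / 4 - β * (x + y) / 2) * exp (-β / 4) * exp (β * (x + y - 1) / 2) =
        exp (-β * 1) := by rw [← exp_add, ← exp_add]; congr 1; ring
    have e4 : exp (-β / 4 - β * (x + y) / 2) * exp (-β / 4) * exp (-(β * (x + y - 1) / 2)) =
        exp (-β * x) * exp (-β * y) := by
      rw [← exp_add, ← exp_add, ← exp_add]; congr 1; ring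
    rw [hD, limitDenom, cosh_eq, cosh_eq]
    linear_combination mul_qNumberLimit β 1 -
      (1 - exp (-β * x)) * mul_qNumberLimit β y + e3 + e4 - e1 - e2
  have hD0 : D ≠ 0 := by
    intro h0
    rw [h0, mul_zero] at hmul
    exact (mul_ne_zero hβ h) hmul
  have hsinh : exp (-β / 2) * (2 * sinh (β / 2)) = β * qNumberLimit β 1 := by
    have e1 : exp (-β / 2) * exp (β / 2) = 1 := by rw [← exp_add]; simp; ring
    have e2 : exp (-β / 2) * exp (-(β / 2)) = exp (-β * 1) := by
      rw [← exp_add]; congr 1; ring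
    rw [mul_qNumberLimit, sinh_eq]
    linear_combination e1 - e2
  have hsq : exp (-β / 4 - β * (x + y) / 2) ^ 2 =
      exp (-β / 2) * (exp (-β * y) * exp (-β * x)) := by
    rw [← exp_nat_mul, ← exp_add, ← exp_add]; congr 1; push_cast; ring
  rw [div_eq_div_iff (pow_ne_zero _ hD0) (pow_ne_zero _ h)]
  have hmul2 : β ^ 2 * limitDenom β x y ^ 2 =
      4 * (exp (-β / 2) * (exp (-β * y) * exp (-β * x))) * D ^ 2 := by
    rw [← hsq, ← mul_pow, hmul]; ring
  have hb2 : β ^ 2 ≠ 0 := pow_ne_zero _ hβ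
  apply mul_left_cancel₀ hb2
  linear_combination (β / 2 * sinh (β / 2)) * hmul2 +
    β * exp (-β * y) * exp (-β * x) * D ^ 2 * hsinh

lemma hasDerivAt_limitCDF {β x y : ℝ} (h : limitDenom β x y ≠ 0) :
    HasDerivAt (limitCDF β x) (mallowsU x y β) y := by
  have h1 := hasDerivAt_qNumberLimit β y
  have h2 : HasDerivAt (limitDenom β x) (-((1 - exp (-β * x)) * exp (-β * y))) y :=
    (h1.const_mul (1 - exp (-β * x))).const_sub (qNumberLimit β 1)
  have h3 := (h1.mul_const (exp (-β * x))).div h2 h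
  rw [mallowsU_eq h]
  refine h3.congr_deriv ?_
  congr 1
  unfold limitDenom
  ring

lemma integral_mallowsU (β : ℝ) {x y₁ y₂ : ℝ} (hx0 : 0 ≤ x) (hx1 : x ≤ 1) (hy₁ : 0 ≤ y₁)
    (hy₁₂ : y₁ ≤ y₂) (hy₂ : y₂ ≤ 1) :
    ∫ y in y₁..y₂, mallowsU x y β = limitCDF β x y₂ - limitCDF β x y₁ := by
  have hD : ∀ y ∈ Set.uIcc y₁ y₂, limitDenom β x y ≠ 0 := by
    intro y hy
    rw [Set.uIcc_of_le hy₁₂] at hy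
    exact (limitDenom_pos β hx0 hx1 (hy₁.trans hy.1) (hy.2.trans hy₂)).ne'
  refine intervalIntegral.integral_eq_sub_of_hasDerivAt
    (fun y hy => hasDerivAt_limitCDF (hD y hy)) ?_
  have hc : Continuous (qNumberLimit β) :=
    continuous_iff_continuousAt.2 fun y => (hasDerivAt_qNumberLimit β y).continuousAt
  have hcont : ContinuousOn
      (fun y => exp (-β * y) * exp (-β * x) * qNumberLimit β 1 / limitDenom β x y ^ 2)
      (Set.uIcc y₁ y₂) := by
    refine ContinuousOn.div (by fun_prop) ?_ fun y hy => pow_ne_zero _ (hD y hy)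
    unfold limitDenom
    fun_prop
  exact (hcont.congr fun y hy => mallowsU_eq (hD y hy)).intervalIntegrable

end Limit

section Asymptotics

open Real

variable {β : ℝ} {q : ℕ → ℝ}

lemma tendsto_mul_log_of_tendsto_mul_one_sub
    (hβ : Tendsto (fun n : ℕ => (n : ℝ) * (1 - q n)) atTop (nhds β)) :
    Tendsto (fun n : ℕ => (n : ℝ) * log (q n)) atTop (nhds (-β)) := by
  have h : Tendsto (fun n : ℕ => (n : ℝ) * (q n - 1)) atTop (nhds (-β)) :=
    hβ.neg.congr fun n => by ring
  exact (tendsto_nat_mul_log_one_add_of_tendsto h).congr fun n => by ring_nf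

lemma pow_eq_exp_mul_log {r : ℝ} (hr : 0 < r) {n : ℕ} (hn : 0 < n) (b : ℕ) :
    r ^ b = exp ((n * log r) * ((b : ℝ) / n)) := by
  have hn' : (n : ℝ) ≠ 0 := by positivity
  rw [show (n * log r) * ((b : ℝ) / n) = b * log r by field_simp, exp_nat_mul, exp_log hr]

lemma pow_le_exp_abs_mul_log {r : ℝ} (hr : 0 < r) {n : ℕ} (hn : 0 < n) {b : ℕ} (hb : b ≤ n) :
    r ^ b ≤ exp |n * log r| := by
  rw [pow_eq_exp_mul_log hr hn b]
  exact exp_le_exp_abs _ (by positivity) (div_le_one_of_le₀ (by exact_mod_cast hb) (by positivity))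

lemma abs_exp_sub_one_le_exp_abs_sub_one (z : ℝ) : |exp z - 1| ≤ exp |z| - 1 := by
  rcases le_total 0 z with h | h
  · rw [abs_of_nonneg h, abs_of_nonneg (by linarith [add_one_le_exp z])]
  · rw [abs_of_nonpos h, abs_of_nonpos (by linarith [exp_le_one_iff.2 h])]
    linarith [add_one_le_exp z, add_one_le_exp (-z)]

lemma abs_pow_sub_one_le {r : ℝ} (hr : 0 < r) {n : ℕ} (hn : 0 < n) {b : ℕ} (hb : b ≤ n) :
    |r ^ b - 1| ≤ exp |n * log r| - 1 := by
  rw [pow_eq_exp_mul_log hr hn b]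
  refine (abs_exp_sub_one_le_exp_abs_sub_one _).trans ?_
  have h1 : (b : ℝ) / n ≤ 1 := div_le_one_of_le₀ (by exact_mod_cast hb) (by positivity)
  have h2 : |n * log r * ((b : ℝ) / n)| ≤ |n * log r| := by
    rw [abs_mul, abs_of_nonneg (show (0 : ℝ) ≤ b / n by positivity)]
    exact mul_le_of_le_one_right (abs_nonneg _) h1
  linarith [exp_le_exp.2 h2]

lemma tendsto_qNumber_div (hq : ∀ n, 0 < q n)
    (hβ : Tendsto (fun n : ℕ => (n : ℝ) * (1 - q n)) atTop (nhds β))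
    {j : ℕ → ℕ} (hj : ∀ n, j n ≤ n) {y : ℝ}
    (hy : Tendsto (fun n : ℕ => (j n : ℝ) / n) atTop (nhds y)) :
    Tendsto (fun n : ℕ => qNumber (q n) (j n) / n) atTop (nhds (qNumberLimit β y)) := by
  have hθ := tendsto_mul_log_of_tendsto_mul_one_sub hβ
  by_cases h0 : β = 0
  · subst h0
    have hlim : Tendsto (fun n : ℕ => exp |n * log (q n)| - 1) atTop (nhds 0) := by
      have := (continuous_exp.tendsto _).comp hθ.abs
      simpa using this.sub_const 1
    have hdiff : Tendsto (fun n : ℕ => qNumber (q n) (j n) / n - (j n : ℝ) / n) atTop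
        (nhds 0) := by
      refine squeeze_zero_norm' ?_ hlim
      filter_upwards [eventually_gt_atTop 0] with n hn
      have hn' : (0 : ℝ) < n := by exact_mod_cast hn
      have hsum : qNumber (q n) (j n) - j n = ∑ b ∈ Finset.range (j n), (q n ^ b - 1) := by
        simp [qNumber]
      rw [← sub_div, hsum, norm_div, norm_of_nonneg hn'.le, div_le_iff₀ hn']
      calc _ ≤ ∑ b ∈ Finset.range (j n), (exp |n * log (q n)| - 1) :=
            norm_sum_le_of_le _ fun b hb => abs_pow_sub_one_le (hq n) hn
              ((Finset.mem_range.1 hb).le.trans (hj n))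
        _ = j n * (exp |n * log (q n)| - 1) := by
            rw [Finset.sum_const, Finset.card_range, nsmul_eq_mul]
        _ ≤ (exp |n * log (q n)| - 1) * n := by
            rw [mul_comm]
            have hjn : (j n : ℝ) ≤ n := by exact_mod_cast hj n
            have : 0 ≤ exp |n * log (q n)| - 1 :=
              sub_nonneg.2 (one_le_exp (abs_nonneg _))
            gcongr
    have := hdiff.add hy
    simpa [qNumberLimit] using this
  · have hpow : Tendsto (fun n : ℕ => q n ^ j n) atTop (nhds (exp (-β * y))) := by
      refine ((continuous_exp.tendsto _).comp (hθ.mul hy)).congr' ?_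
      filter_upwards [eventually_gt_atTop 0] with n hn
      exact (pow_eq_exp_mul_log (hq n) hn (j n)).symm
    rw [qNumberLimit, if_neg h0]
    refine ((hpow.const_sub 1).div hβ h0).congr' ?_
    filter_upwards [hβ.eventually_ne h0] with n hn
    have h1 : (n : ℝ) ≠ 0 := left_ne_zero_of_mul hn
    have h2 : 1 - q n ≠ 0 := right_ne_zero_of_mul hn
    simp only [Pi.div_apply]
    rw [← qNumber_mul_one_sub]
    field_simp

/-- The filter on pairs `(n, i)` expressing `n → ∞` uniformly in `1 ≤ i ≤ n`. -/
def indexFilter : Filter (ℕ × ℕ) :=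
  comap Prod.fst atTop ⊓ 𝓟 {p | 1 ≤ p.2 ∧ p.2 ≤ p.1}

lemma tendsto_fst_indexFilter : Tendsto Prod.fst indexFilter atTop :=
  tendsto_comap.mono_left inf_le_left

lemma eventually_indexFilter : ∀ᶠ p in indexFilter, 1 ≤ p.2 ∧ p.2 ≤ p.1 :=
  mem_inf_of_right (mem_principal_self _)

lemma eventually_indexFilter_iff {r : ℕ × ℕ → Prop} :
    (∀ᶠ p in indexFilter, r p) ↔ ∃ N : ℕ, ∀ n ≥ N, ∀ i ∈ Finset.Icc 1 n, r (n, i) := by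
  rw [indexFilter, eventually_inf_principal, eventually_comap, eventually_atTop]
  constructor
  · rintro ⟨N, hN⟩
    exact ⟨N, fun n hn i hi => hN n hn (n, i) rfl (Finset.mem_Icc.1 hi)⟩
  · rintro ⟨N, hN⟩
    exact ⟨N, by rintro _ hn ⟨n, i⟩ rfl hi; exact hN _ hn i (Finset.mem_Icc.2 hi)⟩

lemma eventually_div_mem_Icc :
    ∀ᶠ p in indexFilter, 0 ≤ (p.2 / p.1 : ℝ) ∧ (p.2 / p.1 : ℝ) ≤ 1 := by
  filter_upwards [eventually_indexFilter] with p hp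
  exact ⟨by positivity, div_le_one_of_le₀ (by exact_mod_cast hp.2) (by positivity)⟩

lemma tendsto_pow_pred_sub_exp (hq : ∀ n, 0 < q n)
    (hβ : Tendsto (fun n : ℕ => (n : ℝ) * (1 - q n)) atTop (nhds β)) :
    Tendsto (fun p : ℕ × ℕ => q p.1 ^ (p.2 - 1) - exp (-β * (p.2 / p.1))) indexFilter
      (nhds 0) := by
  have hθ := (tendsto_mul_log_of_tendsto_mul_one_sub hβ).comp tendsto_fst_indexFilter
  have hinv : Tendsto (fun p : ℕ × ℕ => ((p.1 : ℝ))⁻¹) indexFilter (nhds 0) :=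
    (tendsto_inv_atTop_nhds_zero_nat (𝕜 := ℝ)).comp tendsto_fst_indexFilter
  have h1 : Tendsto (fun p : ℕ × ℕ => (p.2 / p.1 : ℝ) * (p.1 * log (q p.1) + β)) indexFilter
      (nhds 0) := by
    refine bdd_le_mul_tendsto_zero' 1 ?_ (by simpa using hθ.add_const β)
    filter_upwards [eventually_div_mem_Icc] with p hp
    rw [abs_of_nonneg hp.1]
    exact hp.2
  have h2 : Tendsto (fun p : ℕ × ℕ => exp ((p.2 / p.1 : ℝ) * (p.1 * log (q p.1) + β) -
      (p.1 * log (q p.1)) * (p.1 : ℝ)⁻¹) - 1) indexFilter (nhds 0) := by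
    have h := (continuous_exp.tendsto _).comp (h1.sub (hθ.mul hinv))
    simpa using h.sub_const 1
  have h3 := bdd_le_mul_tendsto_zero' (l := indexFilter)
    (f := fun p : ℕ × ℕ => exp (-β * (p.2 / p.1))) (exp |-β|) ?_ h2
  · refine h3.congr' ?_
    filter_upwards [eventually_indexFilter] with p hp
    have hn : 0 < p.1 := by omega
    have hn' : (p.1 : ℝ) ≠ 0 := by positivity
    rw [mul_sub, mul_one, ← exp_add, pow_eq_exp_mul_log (hq p.1) hn, Nat.cast_sub hp.1]
    congr 2
    push_cast
    field_simp
    ring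
  · filter_upwards [eventually_div_mem_Icc] with p hp
    rw [abs_of_pos (exp_pos _)]
    exact exp_le_exp_abs _ hp.1 hp.2

lemma tendsto_zero_of_sq_tendsto_zero {α : Type*} {l : Filter α} {f : α → ℝ}
    (h : Tendsto (fun x => f x ^ 2) l (nhds 0)) : Tendsto f l (nhds 0) := by
  rw [tendsto_zero_iff_abs_tendsto_zero]
  have := (continuous_sqrt.tendsto 0).comp h
  simpa [Function.comp_def, sqrt_sq_eq_abs] using this

/-- The Mallows probability that `σ(i) ≤ j`, with one-based indices. -/
noncomputable def marginalCDF (n : ℕ) (r : ℝ) (i j : ℕ) : ℝ :=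
  mallowsExp n r (fun σ => if permAct n σ i ≤ j then 1 else 0)

lemma abs_marginalCDF_le_one (n : ℕ) {r : ℝ} (hr : 0 < r) (i j : ℕ) :
    |marginalCDF n r i j| ≤ 1 := by
  have h0 := mallowsExp_mono (n := n) hr (f := fun _ => 0)
    (g := fun σ => if permAct n σ i ≤ j then 1 else 0) (fun σ => by split_ifs <;> simp)
  have h1 := mallowsExp_mono (n := n) hr (g := fun _ => 1)
    (f := fun σ => if permAct n σ i ≤ j then 1 else 0) (fun σ => by split_ifs <;> simp)
  rw [mallowsExp_const hr] at h0 h1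
  rw [marginalCDF, abs_of_nonneg h0]
  exact h1

lemma marginalCDF_bound {n : ℕ} {r : ℝ} (hr : 0 < r) {i j : ℕ} (hj : j ≤ n) (hi : 1 ≤ i)
    (hin : i ≤ n) :
    (marginalCDF n r i j * (qNumber r n / n - (1 - r ^ (i - 1)) * (qNumber r j / n)) -
        qNumber r j / n * r ^ (i - 1)) ^ 2 ≤
      (n * (1 - r)) ^ 2 * (qNumber r n / n) ^ 2 * exp |n * log r| ^ 2 * (n : ℝ)⁻¹ := by
  have hn : 0 < n := by omega
  have hn' : (0 : ℝ) < n := by exact_mod_cast hn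
  have hk : i - 1 < n := by omega
  have h := mallows_marginal_bound (n := n) hr hj hk
    (C := exp |n * log r|) (fun b hb => pow_le_exp_abs_mul_log hr hn hb)
  have hP : marginalCDF n r i j =
      mallowsExp n r (fun σ => if (σ ⟨i - 1, hk⟩ : ℕ) < j then 1 else 0) := by
    unfold marginalCDF permAct
    simp [hi, hin]
  rw [hP]
  set P := mallowsExp n r (fun σ => if (σ ⟨i - 1, hk⟩ : ℕ) < j then 1 else 0)
  have e1 : P * (qNumber r n / n - (1 - r ^ (i - 1)) * (qNumber r j / n)) -
      qNumber r j / n * r ^ (i - 1) =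
      (P * (qNumber r n - (1 - r ^ (i - 1)) * qNumber r j) - qNumber r j * r ^ (i - 1)) / n := by
    field_simp
  rw [e1, div_pow, div_le_iff₀ (by positivity)]
  refine h.trans_eq ?_
  field_simp

/-- The marginal distribution function at level `j n ~ n y` converges uniformly in the index. -/
lemma tendsto_marginalCDF_sub (hq : ∀ n, 0 < q n)
    (hβ : Tendsto (fun n : ℕ => (n : ℝ) * (1 - q n)) atTop (nhds β))
    {j : ℕ → ℕ} (hj : ∀ n, j n ≤ n) {y : ℝ} (hy0 : 0 ≤ y) (hy1 : y ≤ 1)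
    (hy : Tendsto (fun n : ℕ => (j n : ℝ) / n) atTop (nhds y)) :
    Tendsto (fun p : ℕ × ℕ => marginalCDF p.1 (q p.1) p.2 (j p.1) -
      limitCDF β (p.2 / p.1) y) indexFilter (nhds 0) := by
  have hfst := tendsto_fst_indexFilter
  have hs := (tendsto_qNumber_div hq hβ hj hy).comp hfst
  have hone : Tendsto (fun n : ℕ => (n : ℝ) / n) atTop (nhds 1) := by
    refine tendsto_const_nhds.congr' ?_
    filter_upwards [eventually_gt_atTop 0] with n hn
    have : (n : ℝ) ≠ 0 := by positivity
    field_simp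
  have ht := (tendsto_qNumber_div hq hβ (fun n => le_rfl) hone).comp hfst
  have he := tendsto_pow_pred_sub_exp hq hβ
  simp only [Function.comp_def] at hs ht
  set s : ℕ × ℕ → ℝ := fun p => qNumber (q p.1) (j p.1) / p.1 with hs_def
  set t : ℕ × ℕ → ℝ := fun p => qNumber (q p.1) p.1 / p.1 with ht_def
  set e : ℕ × ℕ → ℝ := fun p => q p.1 ^ (p.2 - 1) with he_def
  set e' : ℕ × ℕ → ℝ := fun p => exp (-β * (p.2 / p.1)) with he'_def
  set P : ℕ × ℕ → ℝ := fun p => marginalCDF p.1 (q p.1) p.2 (j p.1) with hP_def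
  set ψ := qNumberLimit β y with hψ
  have hs0 : Tendsto (fun p => s p - ψ) indexFilter (nhds 0) := by
    simpa using hs.sub_const ψ
  have ht0 : Tendsto (fun p => t p - qNumberLimit β 1) indexFilter (nhds 0) := by
    simpa using ht.sub_const (qNumberLimit β 1)
  have hse : Tendsto (fun p => (e p - e' p) * s p + e' p * (s p - ψ)) indexFilter (nhds 0) := by
    have h1 : Tendsto (fun p => e' p * (s p - ψ)) indexFilter (nhds 0) := by
      refine bdd_le_mul_tendsto_zero' (exp |-β|) ?_ hs0
      filter_upwards [eventually_div_mem_Icc] with p hp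
      rw [abs_of_pos (exp_pos _)]
      exact exp_le_exp_abs _ hp.1 hp.2
    have h2 := (he.mul hs).add h1
    rwa [zero_mul, add_zero] at h2
  have herr : Tendsto (fun p => P p * (t p - (1 - e p) * s p) - s p * e p) indexFilter
      (nhds 0) := by
    refine tendsto_zero_of_sq_tendsto_zero ?_
    have hlim := (((((hβ.comp hfst).pow 2).mul (ht.pow 2)).mul
      (((continuous_exp.tendsto _).comp
        ((tendsto_mul_log_of_tendsto_mul_one_sub hβ).comp hfst).abs).pow 2)).mul
      ((tendsto_inv_atTop_nhds_zero_nat (𝕜 := ℝ)).comp hfst))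
    rw [mul_zero] at hlim
    refine squeeze_zero' (Eventually.of_forall fun p => sq_nonneg _) ?_ hlim
    filter_upwards [eventually_indexFilter] with p hp
    exact marginalCDF_bound (hq p.1) (hj p.1) hp.1 hp.2
  have hnum : Tendsto (fun p => P p * ((s p - ψ) - (t p - qNumberLimit β 1) -
      ((e p - e' p) * s p + e' p * (s p - ψ))) +
      (P p * (t p - (1 - e p) * s p) - s p * e p) +
      ((e p - e' p) * s p + e' p * (s p - ψ))) indexFilter (nhds 0) := by
    have h1 := bdd_le_mul_tendsto_zero' (l := indexFilter) (f := P) 1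
      (Eventually.of_forall fun p => abs_marginalCDF_le_one p.1 (hq p.1) p.2 (j p.1))
      (by have h2 := (hs0.sub ht0).sub hse; rwa [sub_zero, sub_zero] at h2)
    have h3 := (h1.add herr).add hse
    rwa [add_zero, add_zero] at h3
  have hfinal := bdd_le_mul_tendsto_zero' (l := indexFilter)
    (f := fun p : ℕ × ℕ => (limitDenom β (p.2 / p.1) y)⁻¹)
    (exp (-|β|) * qNumberLimit β 1)⁻¹ ?_ hnum
  · refine hfinal.congr' ?_
    filter_upwards [eventually_div_mem_Icc] with p hp
    have hD := limitDenom_pos β hp.1 hp.2 hy0 hy1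
    have hcdf : limitDenom β (p.2 / p.1) y * limitCDF β (p.2 / p.1) y = ψ * e' p :=
      mul_div_cancel₀ _ hD.ne'
    have hden : limitDenom β (p.2 / p.1) y = qNumberLimit β 1 - (1 - e' p) * ψ := rfl
    rw [inv_mul_eq_iff_eq_mul₀ hD.ne']
    change _ = _ * (P p - _)
    linear_combination hcdf - P p * hden
  · filter_upwards [eventually_div_mem_Icc] with p hp
    have hD := limitDenom_pos β hp.1 hp.2 hy0 hy1
    rw [abs_of_pos (inv_pos.2 hD)]
    exact inv_anti₀ (mul_pos (exp_pos _) (qNumberLimit_one_pos β))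
      (le_limitDenom β hp.1 hp.2 hy0 hy1)

lemma mallowsProb_Icc_eq {n : ℕ} (hn : 0 < n) (r : ℝ) (i : ℕ) {y₁ y₂ : ℝ} (hy₁ : 0 ≤ y₁)
    (hy₁₂ : y₁ ≤ y₂) (hi : 1 ≤ i) :
    mallowsProb n r (fun σ => (permAct n σ i : ℝ) / n ∈ Set.Icc y₁ y₂) =
      marginalCDF n r i ⌊y₂ * n⌋₊ - marginalCDF n r i (⌈y₁ * n⌉₊ - 1) := by
  classical
  have hn' : (0 : ℝ) < n := by exact_mod_cast hn
  rw [mallowsProb_eq_mallowsExp, marginalCDF, marginalCDF, ← mallowsExp_sub]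
  congr 1
  ext σ
  have hpos : 1 ≤ permAct n σ i := by
    unfold permAct
    split_ifs <;> omega
  have h1 : (permAct n σ i : ℝ) / n ∈ Set.Icc y₁ y₂ ↔
      ⌈y₁ * n⌉₊ ≤ permAct n σ i ∧ permAct n σ i ≤ ⌊y₂ * n⌋₊ := by
    rw [Set.mem_Icc, le_div_iff₀ hn', div_le_iff₀ hn', Nat.ceil_le,
      Nat.le_floor_iff (by have := hy₁.trans hy₁₂; positivity)]
  have h2 : ⌈y₁ * n⌉₊ ≤ ⌊y₂ * n⌋₊ + 1 :=
    (Nat.ceil_le_ceil (by gcongr)).trans (Nat.ceil_le_floor_add_one _)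
  simp only [h1]
  split_ifs <;> first | omega | norm_num

end Asymptotics

/-- **Lemma 4.1.** Let `A = [y₁,y₂] ⊆ [0,1]` and `n(1-qₙ) → β`. Then
`max_{i ∈ [n]} | μ_{n,qₙ}(π(i)/n ∈ A) − ∫_{y₁}^{y₂} u(i/n, y, β) dy | → 0`;
i.e. the convergence is uniform over `i ∈ {1,…,n}`. -/
theorem mallows_marginal_uniform_convergence
    (y₁ y₂ : ℝ) (hy₁ : 0 ≤ y₁) (hy₁₂ : y₁ ≤ y₂) (hy₂ : y₂ ≤ 1) (β : ℝ)
    (q : ℕ → ℝ) (hq : ∀ n, 0 < q n)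
    (hβ : Tendsto (fun n : ℕ => (n : ℝ) * (1 - q n)) atTop (nhds β)) :
    ∀ ε > (0 : ℝ), ∃ N : ℕ, ∀ n ≥ N, ∀ i ∈ Finset.Icc 1 n,
      |mallowsProb n (q n) (fun π => (permAct n π i : ℝ) / n ∈ Set.Icc y₁ y₂)
        - (∫ y in y₁..y₂, mallowsU ((i : ℝ) / n) y β)| < ε := by
  intro ε hε
  have hle : ∀ (n : ℕ) {y : ℝ}, y ≤ 1 → y * n ≤ n := fun n y hy =>
    mul_le_of_le_one_left (Nat.cast_nonneg n) hy
  have h₂ := tendsto_marginalCDF_sub hq hβ (j := fun n => ⌊y₂ * n⌋₊)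
    (fun n => Nat.floor_le_of_le (hle n hy₂)) (hy₁.trans hy₁₂) hy₂
    ((tendsto_nat_floor_mul_div_atTop (hy₁.trans hy₁₂)).comp tendsto_natCast_atTop_atTop)
  have h₁ := tendsto_marginalCDF_sub hq hβ (j := fun n => ⌈y₁ * n⌉₊ - 1)
    (fun n => (Nat.sub_le _ _).trans (Nat.ceil_le.2 (hle n (hy₁₂.trans hy₂)))) hy₁
    (hy₁₂.trans hy₂) (by
      have hc := (tendsto_nat_ceil_mul_div_atTop hy₁).comp
        (tendsto_natCast_atTop_atTop (R := ℝ))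
      have hinv := tendsto_inv_atTop_nhds_zero_nat (𝕜 := ℝ)
      refine tendsto_of_tendsto_of_tendsto_of_le_of_le (by simpa using hc.sub hinv) hc ?_ ?_
      · intro n
        simp only
        rw [← one_div, ← sub_div]
        gcongr
        rw [sub_le_iff_le_add]
        exact_mod_cast (by omega : ⌈y₁ * n⌉₊ ≤ ⌈y₁ * n⌉₊ - 1 + 1)
      · intro n
        simp only [Function.comp_apply]
        gcongr
        exact Nat.sub_le _ _)
  have h := h₂.sub h₁
  rw [sub_zero, Metric.tendsto_nhds] at h
  have key := (h ε hε).and (eventually_indexFilter.and eventually_div_mem_Icc)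
  rw [eventually_indexFilter_iff] at key
  obtain ⟨N, hN⟩ := key
  refine ⟨N, fun n hn i hi => ?_⟩
  obtain ⟨hdist, ⟨hi1, hin⟩, hx0, hx1⟩ := hN n hn i hi
  rw [mallowsProb_Icc_eq (by omega) (q n) i hy₁ hy₁₂ hi1,
    integral_mallowsU β hx0 hx1 hy₁ hy₁₂ hy₂]
  rw [dist_zero_right, Real.norm_eq_abs] at hdist
  convert hdist using 2
  ring
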